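/- arXiv:1010.5178 — 4 statements merged into one kernel-verified Lean document; each statement's English description precedes it below -/
import Mathlib

section
/- Fix a real number m > 1 and s ∈ {-1, 1}. For every real x > 0, the series f_s(x) = (2/log m) · ∑_{k=1}^∞ Re( Γ(s - 2πik/log m) · exp(2πik · log x / log m) ) converges absolutely, and there is a constant C (depending only on m and s) such that |f_s(x)| ≤ C for all x > 0. -/
/-- The general term of the oscillatory series
`Re(Γ(s - 2πik/log m)·exp(2πik·log x/log m))`, for `k ≥ 1` (indexed by `k : ℕ` via `k+1`). -/
noncomputable def oscTerm (m s x : ℝ) (k : ℕ) : ℝ :=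
  (Complex.Gamma ((s : ℂ) - 2 * (Real.pi : ℂ) * Complex.I * ((k : ℂ) + 1) / (Real.log m : ℂ)) *
    Complex.exp (2 * (Real.pi : ℂ) * Complex.I * ((k : ℂ) + 1) * (Real.log x : ℂ) /
      (Real.log m : ℂ))).re

theorem osc_norm_Gamma_le (z : ℂ) (hz : 0 < z.re) : ‖Complex.Gamma z‖ ≤ Real.Gamma z.re := by
  rw [Complex.Gamma_eq_integral hz, Real.Gamma_eq_integral hz, Complex.GammaIntegral]
  refine (MeasureTheory.norm_integral_le_integral_norm _).trans (le_of_eq ?_)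
  refine MeasureTheory.setIntegral_congr_fun measurableSet_Ioi ?_
  intro x hx
  have hx' : 0 < x := hx
  simp only [norm_mul]
  rw [Complex.norm_cpow_eq_rpow_re_of_pos hx', Complex.norm_real, Real.norm_eq_abs,
    abs_of_pos (Real.exp_pos _)]
  simp

theorem osc_Gamma_step (z : ℂ) (hz : z.im ≠ 0) :
    ‖Complex.Gamma z‖ * |z.im| ≤ ‖Complex.Gamma (z + 1)‖ := by
  have h0 : z ≠ 0 := by
    rintro rfl
    simp at hz
  rw [Complex.Gamma_add_one z h0, norm_mul, mul_comm]
  exact mul_le_mul_of_nonneg_right (Complex.abs_im_le_norm z) (norm_nonneg _)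

theorem osc_Gamma_steps (n : ℕ) (z : ℂ) (hz : z.im ≠ 0) :
    ‖Complex.Gamma z‖ * |z.im| ^ n ≤ ‖Complex.Gamma (z + n)‖ := by
  induction n with
  | zero => simp
  | succ n ih =>
    have h1 := osc_Gamma_step (z + n) (by simpa using hz)
    have him : (z + n).im = z.im := by simp
    rw [him] at h1
    calc ‖Complex.Gamma z‖ * |z.im| ^ (n + 1) = (‖Complex.Gamma z‖ * |z.im| ^ n) * |z.im| := by ring
      _ ≤ ‖Complex.Gamma (z + n)‖ * |z.im| := mul_le_mul_of_nonneg_right ih (abs_nonneg _)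
      _ ≤ _ := by
        refine h1.trans (le_of_eq ?_)
        push_cast
        rw [add_assoc]

theorem oscTerm_bound (m : ℝ) (hm : 1 < m) (s : ℝ) (hs : s = -1 ∨ s = 1) (x : ℝ) (k : ℕ) :
    |oscTerm m s x k| ≤
      Real.Gamma (s + 4) / (2 * Real.pi / Real.log m) ^ 4 * (1 / ((k : ℝ) + 1) ^ 4) := by
  have hL : 0 < Real.log m := Real.log_pos hm
  have hpi := Real.pi_pos
  have hk : (0 : ℝ) < (k : ℝ) + 1 := by positivity
  set t : ℝ := 2 * Real.pi / Real.log m * ((k : ℝ) + 1) with ht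
  have htpos : 0 < t := by positivity
  have e1 : (s : ℂ) - 2 * (Real.pi : ℂ) * Complex.I * ((k : ℂ) + 1) / (Real.log m : ℂ)
      = (s : ℂ) - (t : ℂ) * Complex.I := by
    rw [ht]; push_cast; ring
  have e2 : 2 * (Real.pi : ℂ) * Complex.I * ((k : ℂ) + 1) * (Real.log x : ℂ) / (Real.log m : ℂ)
      = ((t * Real.log x : ℝ) : ℂ) * Complex.I := by
    rw [ht]; push_cast; ring
  unfold oscTerm
  rw [e1, e2]
  refine (Complex.abs_re_le_norm _).trans ?_
  rw [norm_mul, Complex.norm_exp_ofReal_mul_I, mul_one]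
  set z : ℂ := (s : ℂ) - (t : ℂ) * Complex.I with hz
  have him : z.im = -t := by simp [hz]
  have hre : (z + (4 : ℕ)).re = s + 4 := by simp [hz]
  have h1 := osc_Gamma_steps 4 z (by rw [him]; linarith)
  have h2 := osc_norm_Gamma_le (z + (4 : ℕ)) (by rw [hre]; rcases hs with h | h <;> linarith)
  rw [hre] at h2
  rw [him, abs_neg, abs_of_pos htpos] at h1
  have h3 : ‖Complex.Gamma z‖ ≤ Real.Gamma (s + 4) / t ^ 4 := by
    rw [le_div_iff₀ (by positivity)]
    exact h1.trans h2
  refine h3.trans (le_of_eq ?_)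
  rw [ht, mul_pow]
  field_simp

/-- For `m > 1` and `s ∈ {-1, 1}`, the series defining
`f_s(x) = (2/log m)·∑_{k≥1} Re(Γ(s - 2πik/log m)·exp(2πik·log x/log m))` converges
absolutely for every `x > 0`, and `f_s` is bounded uniformly in `x > 0`. -/
theorem oscSeries_summable_and_bounded
    (m : ℝ) (hm : 1 < m) (s : ℝ) (hs : s = -1 ∨ s = 1) :
    (∀ x : ℝ, 0 < x → Summable (fun k : ℕ => |oscTerm m s x k|)) ∧
    ∃ C : ℝ, ∀ x : ℝ, 0 < x →
      |(2 / Real.log m) * ∑' k : ℕ, oscTerm m s x k| ≤ C := by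
  have hsum : Summable (fun k : ℕ =>
      Real.Gamma (s + 4) / (2 * Real.pi / Real.log m) ^ 4 * (1 / ((k : ℝ) + 1) ^ 4)) := by
    apply Summable.mul_left
    have h := (summable_nat_add_iff 1).2 (Real.summable_one_div_nat_pow.2 (by norm_num : 1 < 4))
    simpa using h
  have habs : ∀ x : ℝ, Summable (fun k : ℕ => |oscTerm m s x k|) := fun x =>
    Summable.of_nonneg_of_le (fun _ => abs_nonneg _) (oscTerm_bound m hm s hs x) hsum
  refine ⟨fun x _ => habs x, |2 / Real.log m| * ∑' k : ℕ,
    Real.Gamma (s + 4) / (2 * Real.pi / Real.log m) ^ 4 * (1 / ((k : ℝ) + 1) ^ 4), ?_⟩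
  intro x _
  rw [abs_mul]
  refine mul_le_mul_of_nonneg_left ?_ (abs_nonneg _)
  exact tsum_of_norm_bounded (f := oscTerm m s x) hsum.hasSum (oscTerm_bound m hm s hs x)
end

section
/- Fix a real number m > 1 and define f_{-1}(x) = (2/log m) · ∑_{k=1}^∞ Re( Γ(-1 - 2πik/log m) · exp(2πik · log x / log m) ) for x > 0. Then, as L → ∞ through the natural numbers, L·( f_{-1}(L+1) - f_{-1}(L) ) = (2/log m) · ∑_{k=1}^∞ Re( Γ(-1 - 2πik/log m) · exp(2πik · log L / log m) · (2πik/log m) ) + O(1/L). -/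
/-- The function `f_{-1}(x) = (2/log m)·∑_{k≥1} Re(Γ(-1 - 2πik/log m)·exp(2πik·log x/log m))`. -/
noncomputable def fNegOne (m x : ℝ) : ℝ :=
  (2 / Real.log m) * ∑' k : ℕ,
    (Complex.Gamma ((-1 : ℂ) - 2 * (Real.pi : ℂ) * Complex.I * ((k : ℂ) + 1) / (Real.log m : ℂ)) *
      Complex.exp (2 * (Real.pi : ℂ) * Complex.I * ((k : ℂ) + 1) * (Real.log x : ℂ) /
        (Real.log m : ℂ))).re

theorem aux_gamma_bound (y : ℝ) (hy : 0 < y) :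
    ‖Complex.Gamma (-1 - (y : ℂ) * Complex.I)‖ ≤ 16 / y ^ 4 := by
  have hyc : (y : ℂ) * Complex.I ≠ 0 := by
    simp [hy.ne']
  have hne : (-1 - (y : ℂ) * Complex.I) ≠ 0 := by
    intro h
    have := congrArg Complex.re h
    simp at this
  have h1 := Complex.Gamma_add_one _ hne
  have h1' : (-1 - (y : ℂ) * Complex.I) + 1 = -((y : ℂ) * Complex.I) := by ring
  rw [h1'] at h1
  have h2 := Complex.Gamma_add_one _ hyc
  have h3 := Complex.Gamma_mul_Gamma_one_sub (-((y : ℂ) * Complex.I))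
  have h4 : 1 - -((y : ℂ) * Complex.I) = (y : ℂ) * Complex.I + 1 := by ring
  rw [h4, h2] at h3
  have h5 : ‖Complex.Gamma ((y : ℂ) * Complex.I)‖ = ‖Complex.Gamma (-((y : ℂ) * Complex.I))‖ := by
    have := Complex.Gamma_conj ((y : ℂ) * Complex.I)
    have h6 : (starRingEnd ℂ) ((y : ℂ) * Complex.I) = -((y : ℂ) * Complex.I) := by
      simp
    rw [h6] at this
    rw [this, Complex.norm_conj]
  have h7 : (Real.pi : ℂ) * -((y : ℂ) * Complex.I) = ((-(Real.pi * y) : ℝ) : ℂ) * Complex.I := by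
    push_cast; ring
  rw [h7, Complex.sin_mul_I] at h3
  have h8 := congrArg norm h3
  rw [← Complex.ofReal_sinh] at h8
  simp only [norm_mul, norm_div, Complex.norm_I, Complex.norm_real, mul_one, h5, Real.norm_eq_abs,
    Real.sinh_neg, abs_neg] at h8
  have hp := Real.pi_pos
  have hpy : 0 < Real.pi * y := by positivity
  have hs : (Real.pi * y) ^ 5 / 240 ≤ Real.sinh (Real.pi * y) := by
    have e1 := Real.sum_le_exp_of_nonneg hpy.le 6
    have e2 : Real.exp (-(Real.pi * y)) ≤ 1 := Real.exp_le_one_iff.mpr (by linarith)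
    simp [Finset.sum_range_succ, Nat.factorial] at e1
    rw [Real.sinh_eq]
    have : 0 ≤ (Real.pi * y) ^ 2 / 2 + (Real.pi * y) ^ 3 / 6 + (Real.pi * y) ^ 4 / 24 := by positivity
    linarith
  have hs0 : 0 < Real.sinh (Real.pi * y) := lt_of_lt_of_le (by positivity) hs
  rw [abs_of_pos hp, abs_of_pos hs0, abs_of_pos hy] at h8
  have h9 := congrArg norm h1
  rw [norm_mul] at h9
  have h10 : y ≤ ‖(-1 - (y : ℂ) * Complex.I)‖ := by
    have := Complex.abs_im_le_norm (-1 - (y : ℂ) * Complex.I)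
    simpa [abs_of_pos hy] using this
  set g := ‖Complex.Gamma (-1 - (y : ℂ) * Complex.I)‖ with hg
  set a := ‖Complex.Gamma (-((y : ℂ) * Complex.I))‖ with ha
  have hg0 : 0 ≤ g := norm_nonneg _
  have h11 : y * g ≤ a := by rw [h9]; gcongr
  have h12 : a * (y * a) * Real.sinh (Real.pi * y) = Real.pi := by
    rw [h8]; field_simp
  have h13 : (y * g) * (y * (y * g)) * ((Real.pi * y) ^ 5 / 240) ≤ Real.pi := by
    refine le_trans ?_ h12.le
    gcongr
  have h14 : (g * y ^ 4) ^ 2 * Real.pi ^ 4 ≤ 240 := by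
    have : Real.pi * ((g * y ^ 4) ^ 2 * Real.pi ^ 4) ≤ Real.pi * 240 := by
      nlinarith [h13]
    exact le_of_mul_le_mul_left this hp
  have hp1 : 1 ≤ Real.pi ^ 4 := one_le_pow₀ (by linarith [Real.pi_gt_three])
  rw [le_div_iff₀ (by positivity)]
  refine abs_le_of_sq_le_sq' ?_ (by norm_num) |>.2
  nlinarith [sq_nonneg (g * y ^ 4)]

theorem aux_exp (t : ℝ) : ‖Complex.exp ((t : ℂ) * Complex.I) - 1 - (t : ℂ) * Complex.I‖ ≤ 2 * t ^ 2 := by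
  have hn : ‖(t : ℂ) * Complex.I‖ = |t| := by simp
  by_cases h : |t| ≤ 1
  · have := Complex.norm_exp_sub_one_sub_id_le (x := (t : ℂ) * Complex.I) (by rw [hn]; exact h)
    rw [hn, sq_abs] at this
    nlinarith [sq_nonneg t]
  · push Not at h
    have h1 := Real.norm_exp_I_mul_ofReal_sub_one_le (x := t)
    rw [mul_comm, Real.norm_eq_abs] at h1
    have h2 := norm_sub_le (Complex.exp ((t : ℂ) * Complex.I) - 1) ((t : ℂ) * Complex.I)
    rw [hn] at h2
    nlinarith [sq_abs t]

theorem aux_term (y x : ℝ) (hy : 0 < y) (hx : 0 < x) :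
    ‖(x : ℂ) * (Complex.exp ((y * Real.log (x + 1) : ℝ) * Complex.I) -
        Complex.exp ((y * Real.log x : ℝ) * Complex.I)) -
      Complex.exp ((y * Real.log x : ℝ) * Complex.I) * (y * Complex.I)‖ ≤ (2 * y ^ 2 + y) / x := by
  obtain ⟨d, hd⟩ : ∃ d, d = Real.log (x + 1) - Real.log x := ⟨_, rfl⟩
  have hd' : d = Real.log ((x + 1) / x) := by
    rw [hd, Real.log_div (by positivity) (by positivity)]
  have hq : (x + 1) / x = 1 + 1 / x := by field_simp
  have hu : d ≤ 1 / x := by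
    have := Real.log_le_sub_one_of_pos (x := (x + 1) / x) (by positivity)
    rw [← hd', hq] at this; linarith
  have hl : 1 / (x + 1) ≤ d := by
    have := Real.one_sub_inv_le_log_of_pos (x := (x + 1) / x) (by positivity)
    rw [← hd', inv_div] at this
    have e : 1 - x / (x + 1) = 1 / (x + 1) := by field_simp; ring
    linarith
  have hd0 : 0 < d := lt_of_lt_of_le (by positivity) hl
  have hlog : Real.log (x + 1) = Real.log x + d := by rw [hd]; ring
  have key : (x : ℂ) * (Complex.exp ((y * Real.log (x + 1) : ℝ) * Complex.I) -
        Complex.exp ((y * Real.log x : ℝ) * Complex.I)) -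
      Complex.exp ((y * Real.log x : ℝ) * Complex.I) * (y * Complex.I)
      = Complex.exp ((y * Real.log x : ℝ) * Complex.I) *
        ((x : ℂ) * (Complex.exp (((y * d : ℝ) : ℂ) * Complex.I) - 1 - ((y * d : ℝ) : ℂ) * Complex.I)
          + ((y * (x * d - 1) : ℝ) : ℂ) * Complex.I) := by
    have : ((y * Real.log (x + 1) : ℝ) : ℂ) * Complex.I
        = (y * Real.log x : ℝ) * Complex.I + ((y * d : ℝ) : ℂ) * Complex.I := by
      rw [hlog]; push_cast; ring
    rw [this, Complex.exp_add]
    push_cast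
    ring
  rw [key, norm_mul, Complex.norm_exp_ofReal_mul_I, one_mul]
  refine (norm_add_le _ _).trans ?_
  rw [norm_mul, norm_mul, Complex.norm_I, mul_one, Complex.norm_real, Complex.norm_real,
    Real.norm_eq_abs, Real.norm_eq_abs, abs_of_pos hx, abs_mul, abs_of_pos hy, add_div]
  have hxd : x * d ≤ 1 := by
    calc x * d ≤ x * (1 / x) := by gcongr
      _ = 1 := by field_simp
  have hxl : 1 - 1 / x ≤ x * d := by
    have e : x * (1 / (x + 1)) ≤ x * d := by gcongr
    have e2 : x * (1 / (x + 1)) = 1 - 1 / (x + 1) := by field_simp; ring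
    have e3 : 1 / (x + 1) ≤ 1 / x := by gcongr; linarith
    linarith
  have hab : |x * d - 1| ≤ 1 / x := by
    rw [abs_le]; constructor
    · linarith
    · have : 0 < 1 / x := by positivity
      linarith
  have t1 : x * ‖Complex.exp (((y * d : ℝ) : ℂ) * Complex.I) - 1 - ((y * d : ℝ) : ℂ) * Complex.I‖
      ≤ 2 * y ^ 2 / x := by
    calc _ ≤ x * (2 * (y * d) ^ 2) := by gcongr; exact aux_exp _
      _ = 2 * y ^ 2 * (x * d) * d := by ring
      _ ≤ 2 * y ^ 2 * 1 * (1 / x) := by gcongr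
      _ = 2 * y ^ 2 / x := by ring
  have t2 : y * |x * d - 1| ≤ y / x := by
    calc _ ≤ y * (1 / x) := by gcongr
      _ = y / x := by ring
  linarith

theorem aux_sum (c : ℝ) (hc : 0 < c) (p : ℕ) (hp : 1 < p) (A : ℝ) :
    Summable (fun k : ℕ => A / (c * ((k : ℝ) + 1)) ^ p) := by
  have h := (summable_nat_add_iff 1).mpr (Real.summable_one_div_nat_pow.mpr hp)
  have h2 := h.mul_left (A / c ^ p)
  refine h2.congr fun k => ?_
  push_cast
  rw [mul_pow]
  field_simp

/-- For `m > 1`, as `L → ∞` through the naturals,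
`L·(f_{-1}(L+1) - f_{-1}(L)) = (2/log m)·∑_{k≥1} Re(Γ(-1 - 2πik/log m)
  ·exp(2πik·log L/log m)·(2πik/log m)) + O(1/L)`. -/
theorem fNegOne_difference_asymptotic
    (m : ℝ) (hm : 1 < m) :
    ∃ C : ℝ, ∃ N : ℕ, ∀ L : ℕ, N ≤ L →
      |(L : ℝ) * (fNegOne m (L + 1) - fNegOne m L) -
        (2 / Real.log m) * ∑' k : ℕ,
          (Complex.Gamma ((-1 : ℂ) - 2 * (Real.pi : ℂ) * Complex.I * ((k : ℂ) + 1) /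
              (Real.log m : ℂ)) *
            Complex.exp (2 * (Real.pi : ℂ) * Complex.I * ((k : ℂ) + 1) * (Real.log L : ℂ) /
              (Real.log m : ℂ)) *
            (2 * (Real.pi : ℂ) * Complex.I * ((k : ℂ) + 1) / (Real.log m : ℂ))).re|
        ≤ C / L := by
  have hlm : 0 < Real.log m := Real.log_pos hm
  obtain ⟨c, hc⟩ : ∃ c, c = 2 * Real.pi / Real.log m := ⟨_, rfl⟩
  have hc0 : 0 < c := by rw [hc]; have := Real.pi_pos; positivity
  obtain ⟨y, hy⟩ : ∃ y : ℕ → ℝ, y = fun k : ℕ => c * ((k : ℝ) + 1) := ⟨_, rfl⟩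
  have hy0 : ∀ k, 0 < y k := fun k => by rw [hy]; positivity
  obtain ⟨G, hG⟩ : ∃ G : ℕ → ℂ, G = fun k => Complex.Gamma (-1 - (y k : ℂ) * Complex.I) := ⟨_, rfl⟩
  have hGb : ∀ k, ‖G k‖ ≤ 16 / y k ^ 4 := fun k => by rw [hG]; exact aux_gamma_bound _ (hy0 k)
  have hlc : (Real.log m : ℂ) ≠ 0 := by exact_mod_cast hlm.ne'
  have e1 : ∀ k : ℕ, 2 * (Real.pi : ℂ) * Complex.I * ((k : ℂ) + 1) / (Real.log m : ℂ)
      = (y k : ℂ) * Complex.I := fun k => by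
    rw [hy, hc]; push_cast; ring
  have e2 : ∀ (k : ℕ) (x : ℝ), 2 * (Real.pi : ℂ) * Complex.I * ((k : ℂ) + 1) * (Real.log x : ℂ) /
      (Real.log m : ℂ) = (y k * Real.log x : ℝ) * Complex.I := fun k x => by
    rw [hy, hc]; push_cast; ring
  have hf : ∀ x : ℝ, fNegOne m x = (2 / Real.log m) *
      ∑' k : ℕ, (G k * Complex.exp ((y k * Real.log x : ℝ) * Complex.I)).re := fun x => by
    unfold fNegOne
    simp only [e1, e2, hG]
  have hS4 : Summable (fun k => 16 / y k ^ 4) := by rw [hy]; exact aux_sum c hc0 4 (by norm_num) 16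
  have hS3 : Summable (fun k => 16 / y k ^ 3) := by rw [hy]; exact aux_sum c hc0 3 (by norm_num) 16
  have hS2 : Summable (fun k => 32 / y k ^ 2) := by rw [hy]; exact aux_sum c hc0 2 (by norm_num) 32
  have hT : ∀ x : ℝ, Summable (fun k => (G k * Complex.exp ((y k * Real.log x : ℝ) * Complex.I)).re) := by
    intro x
    refine Summable.of_norm_bounded hS4 fun k => ?_
    refine (Complex.abs_re_le_norm _).trans ?_
    rw [norm_mul, Complex.norm_exp_ofReal_mul_I, mul_one]
    exact hGb k
  have hU : ∀ x : ℝ, Summable (fun k => (G k * Complex.exp ((y k * Real.log x : ℝ) * Complex.I) *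
      (y k * Complex.I)).re) := by
    intro x
    refine Summable.of_norm_bounded hS3 fun k => ?_
    refine (Complex.abs_re_le_norm _).trans ?_
    rw [norm_mul, norm_mul, norm_mul, Complex.norm_exp_ofReal_mul_I, mul_one, Complex.norm_I,
      Complex.norm_real, Real.norm_eq_abs, abs_of_pos (hy0 k), mul_one]
    calc _ ≤ 16 / y k ^ 4 * y k := by
          have := hy0 k
          gcongr; exact hGb k
      _ = _ := by have := hy0 k; field_simp
  refine ⟨(2 / Real.log m) * ∑' k, (32 / y k ^ 2 + 16 / y k ^ 3), 1, fun L hL => ?_⟩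
  have hx : (0 : ℝ) < L := by exact_mod_cast hL
  rw [hf, hf]
  simp only [e1, e2]
  have hG' : ∀ k, Complex.Gamma (-1 - (y k : ℂ) * Complex.I) = G k := fun k => by rw [hG]
  simp only [hG']
  obtain ⟨D, hD⟩ : ∃ D : ℕ → ℝ, D = fun k =>
      (L : ℝ) * ((G k * Complex.exp ((y k * Real.log ((L : ℝ) + 1) : ℝ) * Complex.I)).re
        - (G k * Complex.exp ((y k * Real.log (L : ℝ) : ℝ) * Complex.I)).re)
        - (G k * Complex.exp ((y k * Real.log (L : ℝ) : ℝ) * Complex.I) * (y k * Complex.I)).re :=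
    ⟨_, rfl⟩
  have hDs : ∑' k, D k = (L : ℝ) * (∑' k, (G k * Complex.exp ((y k * Real.log ((L : ℝ) + 1) : ℝ) * Complex.I)).re
        - ∑' k, (G k * Complex.exp ((y k * Real.log (L : ℝ) : ℝ) * Complex.I)).re)
        - ∑' k, (G k * Complex.exp ((y k * Real.log (L : ℝ) : ℝ) * Complex.I) * (y k * Complex.I)).re := by
    rw [hD]
    rw [(((hT _).sub (hT _)).mul_left _).tsum_sub (hU _), tsum_mul_left, (hT _).tsum_sub (hT _)]
  have hDb : ∀ k, ‖D k‖ ≤ (32 / y k ^ 2 + 16 / y k ^ 3) / L := by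
    intro k
    have : D k = (G k * ((((L : ℝ) : ℂ)) * (Complex.exp ((y k * Real.log ((L : ℝ) + 1) : ℝ) * Complex.I) -
        Complex.exp ((y k * Real.log (L : ℝ) : ℝ) * Complex.I)) -
      Complex.exp ((y k * Real.log (L : ℝ) : ℝ) * Complex.I) * (y k * Complex.I))).re := by
      rw [hD]
      simp only
      rw [← Complex.sub_re, ← Complex.re_ofReal_mul, ← Complex.sub_re]
      congr 1
      ring
    rw [this]
    refine (Complex.abs_re_le_norm _).trans ?_
    rw [norm_mul]
    have hyk := hy0 k
    calc _ ≤ 16 / y k ^ 4 * ((2 * y k ^ 2 + y k) / L) := by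
          gcongr
          · exact hGb k
          · exact aux_term _ _ hyk hx
      _ = _ := by field_simp; ring
  have hfin : |∑' k, D k| ≤ (∑' k, (32 / y k ^ 2 + 16 / y k ^ 3)) / L := by
    have := tsum_of_norm_bounded ((hS2.add hS3).div_const (L : ℝ)).hasSum hDb
    rw [tsum_div_const] at this
    exact this
  have hrw : ∀ a b d e : ℝ, (L : ℝ) * (a * b - a * d) - a * e = a * (L * (b - d) - e) := by
    intros; ring
  rw [hrw, ← hDs, abs_mul, abs_of_pos (by positivity : 0 < 2 / Real.log m), mul_div_assoc]
  gcongr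
end

section
/- Fix a real number m > 1 and define f_1(x) = (2/log m) · ∑_{k=1}^∞ Re( Γ(1 - 2πik/log m) · exp(2πik · log x / log m) ) for x > 0. Then, as L → ∞ through the natural numbers, f_1(L+1) - f_1(L) = O(1/L); that is, there is a constant C such that |f_1(L+1) - f_1(L)| ≤ C/L for all L ≥ 1. -/
/-- The function `f_1(x) = (2/log m)·∑_{k≥1} Re(Γ(1 - 2πik/log m)·exp(2πik·log x/log m))`. -/
noncomputable def fOne (m x : ℝ) : ℝ :=
  (2 / Real.log m) * ∑' k : ℕ,
    (Complex.Gamma ((1 : ℂ) - 2 * (Real.pi : ℂ) * Complex.I * ((k : ℂ) + 1) / (Real.log m : ℂ)) *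
      Complex.exp (2 * (Real.pi : ℂ) * Complex.I * ((k : ℂ) + 1) * (Real.log x : ℂ) /
        (Real.log m : ℂ))).re

lemma gamma_normSq (t : ℝ) (ht : 0 < t) :
    ‖Complex.Gamma (1 - t * Complex.I)‖ ^ 2 * Real.sinh (Real.pi * t) = Real.pi * t := by
  have hz : (t * Complex.I : ℂ) ≠ 0 := by
    simp [ht.ne']
  have h1 := Complex.Gamma_mul_Gamma_one_sub (t * Complex.I)
  have h2 := Complex.Gamma_add_one (t * Complex.I) hz
  have h3 : Complex.Gamma (t * Complex.I + 1) =
      (starRingEnd ℂ) (Complex.Gamma (1 - t * Complex.I)) := by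
    rw [← Complex.Gamma_conj]
    congr 1
    simp
    ring
  have hs : Real.sinh (Real.pi * t) ≠ 0 := by
    have : 0 < Real.sinh (Real.pi * t) := Real.sinh_pos_iff.mpr (by positivity)
    exact this.ne'
  have h4 : Complex.sin (Real.pi * (t * Complex.I)) = (Real.sinh (Real.pi * t) : ℂ) * Complex.I := by
    rw [← mul_assoc, Complex.sin_mul_I]
    push_cast
    rfl
  have hs' : (Real.sinh (Real.pi * t) : ℂ) ≠ 0 := by exact_mod_cast hs
  have h5 := Complex.mul_conj' (Complex.Gamma (1 - t * Complex.I))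
  rw [← h3, h2] at h5
  rw [h4] at h1
  have h6 : ((‖Complex.Gamma (1 - t * Complex.I)‖ ^ 2 * Real.sinh (Real.pi * t) : ℝ) : ℂ)
      = ((Real.pi * t : ℝ) : ℂ) := by
    rw [Complex.ofReal_mul, Complex.ofReal_pow, ← h5]
    rw [eq_div_iff (mul_ne_zero hs' Complex.I_ne_zero)] at h1
    push_cast at h1 ⊢
    linear_combination (t : ℂ) * h1
  exact_mod_cast h6

lemma sinh_lower (y : ℝ) (hy : 0 ≤ y) : y ^ 7 / 10080 ≤ Real.sinh y := by
  have h := Real.sum_le_exp_of_nonneg hy 8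
  simp only [Finset.sum_range_succ, Finset.sum_range_zero, Nat.factorial] at h
  norm_num at h
  have h2 : Real.exp (-y) ≤ 1 := Real.exp_le_one_iff.mpr (by linarith)
  rw [Real.sinh_eq]
  have : 0 ≤ y ^ 2 ∧ 0 ≤ y ^ 3 ∧ 0 ≤ y ^ 4 ∧ 0 ≤ y ^ 5 ∧ 0 ≤ y ^ 6 := by
    refine ⟨?_, ?_, ?_, ?_, ?_⟩ <;> positivity
  linarith

lemma gamma_bound (t : ℝ) (ht : 0 < t) :
    ‖Complex.Gamma (1 - t * Complex.I)‖ ≤ 101 / t ^ 3 := by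
  have h1 := gamma_normSq t ht
  have hy : t ≤ Real.pi * t := by nlinarith [Real.pi_gt_three]
  have h2 := sinh_lower (Real.pi * t) (by linarith)
  set y := Real.pi * t
  set N := ‖Complex.Gamma (1 - t * Complex.I)‖
  have hy0 : 0 < y := by linarith
  have h3 : N ^ 2 * (y ^ 7 / 10080) ≤ y := by
    refine le_trans ?_ h1.le
    gcongr
  have h4 : N ^ 2 * y ^ 6 ≤ 10080 := by
    have : y * (N ^ 2 * y ^ 6) ≤ y * 10080 := by linarith
    exact le_of_mul_le_mul_left this hy0
  have h5 : N * y ^ 3 ≤ 101 := by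
    apply abs_le_of_sq_le_sq' _ (by norm_num) |>.2
    nlinarith
  rw [le_div_iff₀ (by positivity)]
  refine le_trans ?_ h5
  have : 0 ≤ N := norm_nonneg _
  gcongr

/-- For `m > 1`, there is a constant `C` such that
`|f_1(L+1) - f_1(L)| ≤ C/L` for all natural `L ≥ 1`. -/
theorem fOne_difference_isBigO
    (m : ℝ) (hm : 1 < m) :
    ∃ C : ℝ, ∀ L : ℕ, 1 ≤ L → |fOne m (L + 1) - fOne m L| ≤ C / L := by
  have hl : 0 < Real.log m := Real.log_pos hm
  set a : ℝ := 2 * Real.pi / Real.log m with ha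
  have ha0 : 0 < a := by positivity
  set G : ℕ → ℂ := fun k => Complex.Gamma (1 - ((a * (k + 1) : ℝ) : ℂ) * Complex.I) with hG
  set S : ℝ → ℕ → ℝ := fun x k =>
    (G k * Complex.exp (Complex.I * ((a * (k + 1) * Real.log x : ℝ) : ℂ))).re with hS
  have hl' : (Real.log m : ℂ) ≠ 0 := by exact_mod_cast hl.ne'
  have hf : ∀ x, fOne m x = (2 / Real.log m) * ∑' k, S x k := by
    intro x
    unfold fOne
    congr 1
    apply tsum_congr
    intro k
    simp only [hS, hG, ha]
    congr 3
    · push_cast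
      congr 1
      ring
    · push_cast
      ring_nf
  have hGb : ∀ k, ‖G k‖ ≤ 101 / (a * (k + 1)) ^ 3 := fun k =>
    gamma_bound (a * (k + 1)) (by positivity)
  have hs2 : Summable (fun k : ℕ => 1 / ((k : ℝ) + 1) ^ 2) := by
    have := (summable_nat_add_iff 1).mpr (Real.summable_one_div_nat_pow.mpr (one_lt_two))
    simpa using this
  have hk : ∀ k : ℕ, (a * (k + 1)) * ‖G k‖ ≤ (101 / a ^ 2) * (1 / ((k : ℝ) + 1) ^ 2) := by
    intro k
    calc (a * (k + 1)) * ‖G k‖ ≤ (a * (k + 1)) * (101 / (a * (k + 1)) ^ 3) := by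
          gcongr; exact hGb k
      _ = _ := by field_simp
  have hsum1 : Summable (fun k : ℕ => (a * (k + 1)) * ‖G k‖) :=
    Summable.of_nonneg_of_le (fun k => by positivity) hk (hs2.mul_left _)
  have hsumG : Summable (fun k : ℕ => ‖G k‖) := by
    refine Summable.of_nonneg_of_le (fun k => norm_nonneg _) (fun k => ?_) (hsum1.mul_left a⁻¹)
    rw [← mul_assoc, ← mul_assoc, inv_mul_cancel₀ ha0.ne', one_mul]
    have : 0 ≤ (k : ℝ) := by positivity
    nlinarith [norm_nonneg (G k)]
  have hsumS : ∀ x, Summable (S x) := by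
    intro x
    refine Summable.of_norm_bounded hsumG (fun k => ?_)
    refine (Complex.abs_re_le_norm _).trans ?_
    rw [norm_mul, Complex.norm_exp_I_mul_ofReal, mul_one]
  refine ⟨(2 / Real.log m) * ∑' k : ℕ, (a * (k + 1)) * ‖G k‖, fun L hL => ?_⟩
  have hL0 : (0 : ℝ) < L := by exact_mod_cast hL
  have hlog : Real.log (L + 1) - Real.log L ≤ 1 / L := by
    rw [← Real.log_div (by positivity) hL0.ne']
    refine (Real.log_le_sub_one_of_pos (by positivity)).trans (le_of_eq ?_)
    field_simp
    ring
  have hlog0 : 0 ≤ Real.log (L + 1) - Real.log L :=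
    sub_nonneg.mpr (Real.log_le_log hL0 (by linarith))
  rw [hf, hf, ← mul_sub, ← (hsumS _).tsum_sub (hsumS _), abs_mul,
    abs_of_pos (by positivity : 0 < 2 / Real.log m), mul_div_assoc]
  gcongr
  rw [← Real.norm_eq_abs, ← tsum_div_const]
  refine tsum_of_norm_bounded (hsum1.div_const _).hasSum (fun k => ?_)
  simp only [hS]
  rw [← Complex.sub_re, ← mul_sub]
  refine (Complex.abs_re_le_norm _).trans ?_
  rw [norm_mul]
  have he : ‖Complex.exp (Complex.I * ((a * (k + 1) * Real.log (L + 1) : ℝ) : ℂ)) -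
      Complex.exp (Complex.I * ((a * (k + 1) * Real.log L : ℝ) : ℂ))‖ ≤ a * (k + 1) * (1 / L) := by
    have h1 : Complex.exp (Complex.I * ((a * (k + 1) * Real.log (L + 1) : ℝ) : ℂ)) -
      Complex.exp (Complex.I * ((a * (k + 1) * Real.log L : ℝ) : ℂ)) =
      Complex.exp (Complex.I * ((a * (k + 1) * Real.log L : ℝ) : ℂ)) *
      (Complex.exp (Complex.I * ((a * (k + 1) * (Real.log (L + 1) - Real.log L) : ℝ) : ℂ)) - 1) := by
      rw [mul_sub, ← Complex.exp_add, mul_one]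
      congr 2
      push_cast
      ring
    rw [h1, norm_mul, Complex.norm_exp_I_mul_ofReal, one_mul]
    refine (Real.norm_exp_I_mul_ofReal_sub_one_le).trans ?_
    rw [Real.norm_eq_abs, abs_of_nonneg (by positivity)]
    gcongr
  calc _ ≤ ‖G k‖ * (a * (k + 1) * (1 / L)) := by gcongr
    _ = _ := by ring
end

section
/- Let K ≥ 2 be a natural number and set X = K/(K-1). Then for every real L > 0, the oscillatory term (2/log X) · ∑_{k=1}^∞ Re( Γ(-1 - 2πik/log X) · exp(2πik · log L / log X) · (2πik/log X) ) has absolute value at most 0.000002; equivalently, the periodic function β(L) = 1/2 + γ/log X + that oscillatory term satisfies |β(L) - 1/2 - γ/log X| ≤ 0.000002 for all L > 0 and all K ≥ 2. -/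
lemma aux_gamma_sq (t : ℝ) (ht : 0 < t) :
    ‖Complex.Gamma (1 - Complex.I * t)‖ ^ 2 = Real.pi * t / Real.sinh (Real.pi * t) := by
  have ht' : (t : ℂ) ≠ 0 := by exact_mod_cast ht.ne'
  have h0 : Complex.I * (t : ℂ) ≠ 0 := mul_ne_zero Complex.I_ne_zero ht'
  have h1 := Complex.Gamma_mul_Gamma_one_sub (Complex.I * t)
  have h2 := Complex.Gamma_add_one (Complex.I * t) h0
  have h3 : Complex.Gamma (1 - Complex.I * t) * Complex.Gamma (1 + Complex.I * t)
      = Real.pi * t / Real.sinh (Real.pi * t) := by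
    rw [add_comm 1, h2]
    have h4 : Complex.sin (Real.pi * (Complex.I * t)) =
        Complex.sinh (Real.pi * t) * Complex.I := by
      rw [← Complex.sin_mul_I]; ring_nf
    rw [h4] at h1
    have hs : Complex.sinh (Real.pi * t) ≠ 0 := by
      have : Real.sinh (Real.pi * t) ≠ 0 := (Real.sinh_pos_iff.2 (by positivity)).ne'
      exact_mod_cast this
    calc _ = Complex.I * t * (Complex.Gamma (Complex.I * t) * Complex.Gamma (1 - Complex.I * t)) := by ring
      _ = _ := by
        rw [h1]; push_cast
        have := Complex.I_ne_zero
        field_simp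
  have h5 : Complex.Gamma (1 + Complex.I * t) =
      (starRingEnd ℂ) (Complex.Gamma (1 - Complex.I * t)) := by
    rw [← Complex.Gamma_conj]; simp
  rw [h5, Complex.mul_conj, Complex.normSq_eq_norm_sq] at h3
  exact_mod_cast h3

lemma aux_gamma_shift (t : ℝ) (ht : 0 < t) :
    ‖Complex.Gamma (-1 - Complex.I * t)‖ * t ≤ ‖Complex.Gamma (1 - Complex.I * t)‖ / t := by
  have ht' : (t : ℂ) ≠ 0 := by exact_mod_cast ht.ne'
  have h0 : -(Complex.I * (t : ℂ)) ≠ 0 := neg_ne_zero.2 (mul_ne_zero Complex.I_ne_zero ht')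
  have h1 : -1 - Complex.I * (t : ℂ) ≠ 0 := by
    intro h
    have := congrArg Complex.re h
    simp at this
  have e1 := Complex.Gamma_add_one _ h0
  have e2 := Complex.Gamma_add_one _ h1
  have a1 : -(Complex.I * (t : ℂ)) + 1 = 1 - Complex.I * t := by ring
  have a2 : -1 - Complex.I * (t : ℂ) + 1 = -(Complex.I * t) := by ring
  rw [a1] at e1
  rw [a2] at e2
  rw [e1, e2, norm_mul, norm_mul]
  have n1 : ‖-(Complex.I * (t : ℂ))‖ = t := by simp [abs_of_pos ht]
  have n2 : t ≤ ‖-1 - Complex.I * (t : ℂ)‖ := by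
    have := Complex.abs_im_le_norm (-1 - Complex.I * (t : ℂ))
    simpa [abs_of_pos ht] using this
  rw [n1, mul_div_assoc, mul_comm t, div_mul_cancel₀ _ ht.ne', mul_comm]
  gcongr

lemma aux_exp28 : (1.44 : ℝ) * 10 ^ 12 ≤ Real.exp 28 := by
  have h := Real.exp_one_gt_d9
  have : Real.exp 28 = Real.exp 1 ^ 28 := by rw [← Real.exp_nat_mul]; norm_num
  rw [this]
  calc (1.44 : ℝ) * 10 ^ 12 ≤ 2.7182818283 ^ 28 := by norm_num
    _ ≤ _ := by gcongr

lemma aux_exp14 : (10 : ℝ) ^ 6 ≤ Real.exp 14 := by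
  have h := Real.exp_one_gt_d9
  have : Real.exp 14 = Real.exp 1 ^ 14 := by rw [← Real.exp_nat_mul]; norm_num
  rw [this]
  calc (10 : ℝ) ^ 6 ≤ 2.7182818283 ^ 14 := by norm_num
    _ ≤ _ := by gcongr

lemma aux_sinh (k : ℕ) (y : ℝ) (hy : 28 * ((k : ℝ) + 1) ≤ y) :
    y / Real.sinh y ≤ (6.25e-6 * (1 / 1000) ^ k) ^ 2 := by
  have hk : (0 : ℝ) ≤ k := Nat.cast_nonneg k
  have hy28 : 28 ≤ y := by nlinarith
  have hE : Real.exp 28 ≤ Real.exp y := Real.exp_le_exp.2 hy28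
  have h28 := aux_exp28
  have hs : 0.4999 * Real.exp y ≤ Real.sinh y := by
    rw [Real.sinh_eq]
    have : Real.exp (-y) ≤ 1 := Real.exp_le_one_iff.2 (by linarith)
    norm_num at h28 ⊢
    linarith
  have hyb : y ≤ 28 * Real.exp ((y - 28) / 2) := by
    have := Real.add_one_le_exp ((y - 28) / 2)
    linarith
  have hsplit : Real.exp y = Real.exp ((y - 28) / 2) * Real.exp ((y - 28) / 2) * Real.exp 28 := by
    rw [← Real.exp_add, ← Real.exp_add]; ring_nf
  have hpow : ((10 : ℝ) ^ 6) ^ k ≤ Real.exp ((y - 28) / 2) := by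
    calc ((10 : ℝ) ^ 6) ^ k ≤ Real.exp 14 ^ k := by gcongr; exact aux_exp14
      _ = Real.exp (k * 14) := by rw [← Real.exp_nat_mul]
      _ ≤ _ := Real.exp_le_exp.2 (by linarith)
  set P := Real.exp ((y - 28) / 2)
  set Q := ((10 : ℝ) ^ 6) ^ k with hQ
  have hQ0 : 0 < Q := by positivity
  have hP0 : 0 < P := Real.exp_pos _
  have hR : (6.25e-6 * (1 / 1000) ^ k : ℝ) ^ 2 = 6.25e-6 ^ 2 / Q := by
    rw [hQ, mul_pow, ← pow_mul, mul_comm k 2, pow_mul, div_eq_mul_inv (6.25e-6 ^ 2 : ℝ), ← inv_pow]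
    norm_num
  have hsp : 0 < Real.sinh y := Real.sinh_pos_iff.2 (by linarith)
  rw [hR, div_le_div_iff₀ hsp hQ0]
  calc y * Q ≤ (28 * P) * P := by gcongr
    _ ≤ 6.25e-6 ^ 2 * (0.4999 * (P * P * (1.44 * 10 ^ 12))) := by
      have : 0 ≤ P * P := by positivity
      norm_num
      linarith
    _ ≤ 6.25e-6 ^ 2 * (0.4999 * (P * P * Real.exp 28)) := by gcongr
    _ ≤ _ := by rw [← hsplit]; gcongr


/-- For every natural `K ≥ 2` with `X = K/(K-1)` and every real `L > 0`,
the oscillatory term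
`(2/log X)·∑_{k≥1} Re(Γ(-1 - 2πik/log X)·exp(2πik·log L/log X)·(2πik/log X))`
has absolute value at most `0.000002`; equivalently, the periodic function
`β(L) = 1/2 + γ/log X +` (that term) satisfies `|β(L) - 1/2 - γ/log X| ≤ 0.000002`. -/
theorem betaOsc_small
    (K : ℕ) (hK : 2 ≤ K) (X : ℝ) (hX : X = (K:ℝ)/((K:ℝ)-1))
    (L : ℝ) (hL : 0 < L) :
    |(2 / Real.log X) * ∑' k : ℕ,
        (Complex.Gamma ((-1 : ℂ) - 2 * (Real.pi : ℂ) * Complex.I * ((k : ℂ) + 1) /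
            (Real.log X : ℂ)) *
          Complex.exp (2 * (Real.pi : ℂ) * Complex.I * ((k : ℂ) + 1) * (Real.log L : ℂ) /
            (Real.log X : ℂ)) *
          (2 * (Real.pi : ℂ) * Complex.I * ((k : ℂ) + 1) / (Real.log X : ℂ))).re|
      ≤ 0.000002 := by
  have hK' : (2 : ℝ) ≤ K := by exact_mod_cast hK
  have hX1 : 1 < X := by rw [hX, lt_div_iff₀] <;> linarith
  have hX2 : X ≤ 2 := by rw [hX, div_le_iff₀] <;> linarith
  have ha : 0 < Real.log X := Real.log_pos hX1
  have ha2 : Real.log X ≤ 0.6931471808 :=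
    (Real.log_le_log (by linarith) hX2).trans Real.log_two_lt_d9.le
  set a := Real.log X
  have hpi := Real.pi_gt_d4
  have hpi0 := Real.pi_pos
  have hgeo : HasSum (fun k : ℕ => (a * 6.25e-6 / (2 * Real.pi)) * (1 / 1000 : ℝ) ^ k)
      ((a * 6.25e-6 / (2 * Real.pi)) * (1 - 1 / 1000)⁻¹) :=
    (hasSum_geometric_of_lt_one (by norm_num) (by norm_num)).mul_left _
  rw [abs_mul, abs_of_pos (by positivity : 0 < 2 / a)]
  rw [← Real.norm_eq_abs]
  refine le_trans (mul_le_mul_of_nonneg_left (tsum_of_norm_bounded hgeo ?_) (div_pos two_pos ha).le) ?_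
  · intro k
    set t : ℝ := 2 * Real.pi * (k + 1) / a with htdef
    have hk : (0 : ℝ) ≤ k := Nat.cast_nonneg k
    have ht : 0 < t := by positivity
    have e1 : 2 * (Real.pi : ℂ) * Complex.I * ((k : ℂ) + 1) / (a : ℂ) = Complex.I * t := by
      rw [htdef]; push_cast; ring
    have e2 : 2 * (Real.pi : ℂ) * Complex.I * ((k : ℂ) + 1) * (Real.log L : ℂ) / (a : ℂ)
        = ((t * Real.log L : ℝ) : ℂ) * Complex.I := by
      rw [htdef]; push_cast; ring
    rw [e1, e2]
    refine (Complex.abs_re_le_norm _).trans ?_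
    rw [norm_mul, norm_mul, Complex.norm_exp_ofReal_mul_I, mul_one]
    have n1 : ‖Complex.I * (t : ℂ)‖ = t := by simp [abs_of_pos ht]
    rw [n1]
    refine (aux_gamma_shift t ht).trans ?_
    have hy : 28 * ((k : ℝ) + 1) ≤ Real.pi * t := by
      have : Real.pi * t = (2 * Real.pi * Real.pi / a) * (k + 1) := by rw [htdef]; ring
      rw [this]
      gcongr
      rw [le_div_iff₀ ha]
      nlinarith
    have hG : ‖Complex.Gamma (1 - Complex.I * t)‖ ≤ 6.25e-6 * (1 / 1000) ^ k := by
      have hp : (0 : ℝ) ≤ 6.25e-6 * (1 / 1000) ^ k := mul_nonneg (by norm_num) (by positivity)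
      refine (sq_le_sq₀ (norm_nonneg _) hp).1 ?_
      rw [aux_gamma_sq t ht]
      exact aux_sinh k _ hy
    have ht1 : 2 * Real.pi / a ≤ t := by
      rw [htdef]; refine div_le_div_of_nonneg_right ?_ ha.le; nlinarith
    calc _ ≤ (6.25e-6 * (1 / 1000) ^ k) / (2 * Real.pi / a) := by gcongr
      _ = _ := by field_simp
  · have : 2 / a * (a * 6.25e-6 / (2 * Real.pi) * (1 - 1 / 1000)⁻¹)
        = 6.25e-6 * (1 - 1 / 1000)⁻¹ / Real.pi := by field_simp
    rw [this, div_le_iff₀ hpi0]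
    norm_num at hpi ⊢
    linarith
end
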